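/- Let I = Borel(M,N) be a two-Borel ideal and let μ be a monomial divisible by both M and N. If a vertex Z of Γ_μ(I) has type N and N is not among its elements, then a type N replacement of Z exists; if Z has type M and M is not among its elements, then a type M replacement of Z exists. In either case the replacement is a vertex of Γ_μ(I) that comes later than Z in the fiber sink order (so Z is not a sink of →Γ_μ(I)). -/

import Mathlib

/-!  Monomials in `K[x_1,…,x_n]` are identified with their exponent vectors in `Fin n → ℕ`
(`0`-based indexing: `x_1` corresponds to index `0`).  -/

variable {n : ℕ}

/-- Cumulative exponent vector (`0`-based): `cexp m i = m i + m (i+1) + ⋯ + m (n-1)`,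
so `cexp m i` is the paper's `σ_{i+1}(m)`, and `cexp m n = 0` is the convention
`σ_{n+1}(m) = 0`. -/
def cexp (m : Fin n → ℕ) (i : ℕ) : ℕ :=
  ∑ k : Fin n, if i ≤ (k : ℕ) then m k else 0

/-- `mshift m src tgt` is the exponent vector of `(x_tgt / x_src) · m` (only used when
`src ≠ tgt` and `x_src` divides `m`).  Thus `mshift m j i` is the Borel move `B_{j→i}(m)`
(for `i < j`) and `mshift m i j` is the reverse Borel move `RB_{i→j}(m)` (for `i < j`). -/
def mshift (m : Fin n → ℕ) (src tgt : Fin n) : Fin n → ℕ :=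
  fun k => if k = tgt then m tgt + 1 else if k = src then m src - 1 else m k

/-- `BorelStep a b` : `b` is obtained from `a` by a single Borel move `B_{j→i}`, `i < j`. -/
def BorelStep (a b : Fin n → ℕ) : Prop :=
  ∃ i j : Fin n, i < j ∧ 0 < a j ∧ b = mshift a j i

/-- `InBorel m m'` : `m ∈ Borel(m')`, i.e. `m` is obtained from `m'` by a finite (possibly
empty) sequence of Borel moves. -/
def InBorel (m m' : Fin n → ℕ) : Prop := Relation.ReflTransGen BorelStep m' m

/-- Divisibility of monomials: `m` divides `μ`. -/
def mDvd (m μ : Fin n → ℕ) : Prop := ∀ k, m k ≤ μ k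

/-- `mLexLt m m'` : `m` is lexicographically smaller than `m'` (lex order with
`x_1 > x_2 > ⋯ > x_n`); i.e. `m` comes *later* than `m'` in the lex listing of monomials. -/
def mLexLt (m m' : Fin n → ℕ) : Prop :=
  ∃ i : Fin n, (∀ k, k < i → m k = m' k) ∧ m i < m' i

/-- Total degree of a monomial. -/
def mDeg (m : Fin n → ℕ) : ℕ := ∑ k, m k

/-- A vertex of the fiber graph `Γ_μ(I)`, where `G` is the minimal monomial generating set of
`I`: a multiset of elements of `G` whose product (sum of exponent vectors) is `μ`. -/
def FiberVertex (G : Set (Fin n → ℕ)) (μ : Fin n → ℕ) (Z : Multiset (Fin n → ℕ)) : Prop :=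
  (∀ w ∈ Z, w ∈ G) ∧ Z.sum = μ

/-- Adjacency in the fiber graph `Γ_μ(I)`: `Z` is obtained from `Z'` by applying a Borel move
`B_{j→i}` to one element and the corresponding reverse Borel move `RB_{i→j}` to another,
leaving all other elements unchanged. -/
def FiberAdj (G : Set (Fin n → ℕ)) (μ : Fin n → ℕ) (Z Z' : Multiset (Fin n → ℕ)) : Prop :=
  FiberVertex G μ Z ∧ FiberVertex G μ Z' ∧
  ∃ (W : Multiset (Fin n → ℕ)) (u v u' v' : Fin n → ℕ) (i j : Fin n),
    i < j ∧ Z = u ::ₘ v ::ₘ W ∧ Z' = u' ::ₘ v' ::ₘ W ∧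
    0 < u' j ∧ u = mshift u' j i ∧ 0 < v' i ∧ v = mshift v' i j

/-- `G_M`: the minimal monomial generators of `Borel(M)`, i.e. (for the equigenerated Borel
ideal `I = Borel(M,N)`) the degree-`d` monomials in `Borel(M)`. -/
def gensM (M : Fin n → ℕ) : Set (Fin n → ℕ) := {w | InBorel w M}

/-- `G_N = gens(I) ∖ G_M` for `I = Borel(M,N)`. -/
def gensN (M N : Fin n → ℕ) : Set (Fin n → ℕ) := {w | InBorel w N ∧ ¬ InBorel w M}

/-- The minimal monomial generating set `G` of the two-Borel ideal `I = Borel(M,N)`. -/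
def gens2 (M N : Fin n → ℕ) : Set (Fin n → ℕ) := {w | InBorel w M ∨ InBorel w N}

/-- The fiber sink variable order: `varBefore M N w₁ w₂` says the variable `Y_{w₁}` comes
(strictly) before `Y_{w₂}`.  First come the `w ∈ G_N`, with `Y_N` first (lex-smaller `w`
first), then the `w ∈ G_M`, with `Y_M` last (lex-larger `w` first). -/
def varBefore (M N : Fin n → ℕ) (w₁ w₂ : Fin n → ℕ) : Prop :=
  (w₁ ∈ gensN M N ∧ w₂ ∈ gensM M) ∨
  (w₁ ∈ gensN M N ∧ w₂ ∈ gensN M N ∧ mLexLt w₁ w₂) ∨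
  (w₁ ∈ gensM M ∧ w₂ ∈ gensM M ∧ mLexLt w₂ w₁)

/-- The fiber sink order (reverse lexicographic order induced by the fiber sink variable
order): `laterThan M N Z Z'` says the monomial `∏_{w ∈ Z} Y_w` comes strictly *later* than
`∏_{w ∈ Z'} Y_w`; i.e. at the last variable (in the fiber sink variable order) where the two
multisets have different multiplicities, `Z` has the larger multiplicity. -/
def laterThan (M N : Fin n → ℕ) (Z Z' : Multiset (Fin n → ℕ)) : Prop :=
  ∃ w, Z'.count w < Z.count w ∧ ∀ u, varBefore M N w u → Z.count u = Z'.count u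

/-- A sink of the directed fiber graph `→Γ_μ(I)` for `I = Borel(M,N)` (edges are directed
toward the endpoint that is later in the fiber sink order): a vertex that is later than all
of its neighbors. -/
def IsSink (M N μ : Fin n → ℕ) (Z : Multiset (Fin n → ℕ)) : Prop :=
  FiberVertex (gens2 M N) μ Z ∧
  ∀ Z', FiberAdj (gens2 M N) μ Z Z' → Z' ≠ Z → laterThan M N Z Z'

/-- A type `N` replacement of a vertex `Z` (all of whose elements lie in `G_N`): apply a
reverse Borel move `RB_{i→j}` to the element of `Z` earliest in the fiber sink variable
order, and the corresponding Borel move `B_{j→i}` to another element, both results lying in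
the generating set of `I = Borel(M,N)`. -/
def TypeNRepl (M N : Fin n → ℕ) (Z Z' : Multiset (Fin n → ℕ)) : Prop :=
  ∃ (W : Multiset (Fin n → ℕ)) (e v : Fin n → ℕ) (i j : Fin n),
    i < j ∧ Z = e ::ₘ v ::ₘ W ∧
    (∀ w ∈ Z, w = e ∨ varBefore M N e w) ∧
    0 < e i ∧ 0 < v j ∧
    Z' = mshift e i j ::ₘ mshift v j i ::ₘ W ∧
    mshift e i j ∈ gens2 M N ∧ mshift v j i ∈ gens2 M N

/-- A type `M` replacement of a vertex `Z` (of type `M`): apply a reverse Borel move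
`RB_{i→j}` to the element of `Z` latest in the fiber sink variable order, and the
corresponding Borel move `B_{j→i}` to another element, both results lying in the generating
set of `I = Borel(M,N)`. -/
def TypeMRepl (M N : Fin n → ℕ) (Z Z' : Multiset (Fin n → ℕ)) : Prop :=
  ∃ (W : Multiset (Fin n → ℕ)) (e v : Fin n → ℕ) (i j : Fin n),
    i < j ∧ Z = e ::ₘ v ::ₘ W ∧
    (∀ w ∈ Z, w = e ∨ varBefore M N w e) ∧
    0 < e i ∧ 0 < v j ∧
    Z' = mshift e i j ::ₘ mshift v j i ::ₘ W ∧
    mshift e i j ∈ gens2 M N ∧ mshift v j i ∈ gens2 M N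

/-! Helper lemmas. -/

theorem cexp_of_ge (m : Fin n → ℕ) {k : ℕ} (hk : n ≤ k) : cexp m k = 0 := by
  unfold cexp
  apply Finset.sum_eq_zero
  intro x _
  have := x.2
  rw [if_neg (by omega)]

theorem cexp_succ (m : Fin n → ℕ) (k : Fin n) : cexp m k = m k + cexp m (k + 1) := by
  unfold cexp
  have h : m k = ∑ x : Fin n, if x = k then m x else 0 := by simp
  rw [h, ← Finset.sum_add_distrib]
  apply Finset.sum_congr rfl
  intro x _
  by_cases hx : x = k
  · subst hx; simp
  · have : (x : ℕ) ≠ k := fun h => hx (Fin.ext h)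
    by_cases h1 : (k : ℕ) ≤ x
    · rw [if_pos h1, if_neg hx, if_pos (by omega)]; simp
    · rw [if_neg h1, if_neg hx, if_neg (by omega)]

theorem cexp_anti (m : Fin n → ℕ) {a b : ℕ} (h : a ≤ b) : cexp m b ≤ cexp m a := by
  unfold cexp
  apply Finset.sum_le_sum
  intro x _
  split_ifs <;> omega

theorem mDeg_eq_cexp (m : Fin n → ℕ) : mDeg m = cexp m 0 := by
  simp [mDeg, cexp]

theorem cexp_mshift (m : Fin n → ℕ) (i j : Fin n) (hij : i < j) (hi : 0 < m i) (k : ℕ) :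
    cexp (mshift m i j) k = cexp m k + if (i : ℕ) < k ∧ k ≤ j then 1 else 0 := by
  have key : cexp (mshift m i j) k + (if k ≤ (i : ℕ) then 1 else 0)
      = cexp m k + if k ≤ (j : ℕ) then 1 else 0 := by
    have h1 : ∀ a : Fin n, (if k ≤ (a : ℕ) then 1 else 0)
        = ∑ x : Fin n, if x = a then (if k ≤ (a : ℕ) then 1 else 0) else 0 := by
      intro a; simp
    unfold cexp
    rw [h1 i, h1 j, ← Finset.sum_add_distrib, ← Finset.sum_add_distrib]
    apply Finset.sum_congr rfl
    intro x _
    have hne : i ≠ j := ne_of_lt hij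
    unfold mshift
    by_cases hxj : x = j
    · subst hxj
      simp only [if_true, if_neg hne.symm]
      split_ifs <;> omega
    · by_cases hxi : x = i
      · subst hxi
        simp only [if_true, if_neg hne]
        split_ifs <;> omega
      · simp [hxj, hxi]
  have hij' : (i : ℕ) < j := hij
  split_ifs at key ⊢ <;> omega

/-- Dominance of cumulative exponents. -/
def Dom (m P : Fin n → ℕ) : Prop := (∀ k, cexp m k ≤ cexp P k) ∧ cexp m 0 = cexp P 0

theorem dom_improve (m P : Fin n → ℕ) (h : Dom m P) (hne : m ≠ P) :
    ∃ i j : Fin n, i < j ∧ 0 < m i ∧ m j < P j ∧ Dom (mshift m i j) P := by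
  obtain ⟨hle, h0⟩ := h
  -- some index with strict inequality
  have hex : ∃ k : ℕ, k < n ∧ cexp m k < cexp P k := by
    by_contra hcon
    push Not at hcon
    apply hne
    have heq : ∀ k, cexp m k = cexp P k := by
      intro k
      by_cases hk : k < n
      · exact le_antisymm (hle k) (hcon k hk)
      · rw [cexp_of_ge m (by omega), cexp_of_ge P (by omega)]
    funext k
    have h1 := cexp_succ m k
    have h2 := cexp_succ P k
    have h3 := heq k
    have h4 := heq (k + 1)
    omega
  classical
  let S : Finset (Fin n) := Finset.univ.filter (fun k : Fin n => cexp m k < cexp P k)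
  have hS : S.Nonempty := by
    obtain ⟨k, hk, hk'⟩ := hex
    exact ⟨⟨k, hk⟩, by simp [S, hk']⟩
  obtain ⟨j, hjS, hjmax⟩ := S.exists_max_image id hS
  have hj : cexp m j < cexp P j := by simpa [S] using hjS
  have hj1 : cexp m (j + 1) = cexp P (j + 1) := by
    by_cases hjn : (j : ℕ) + 1 < n
    · by_contra hcon
      have hlt : cexp m (j + 1) < cexp P (j + 1) := lt_of_le_of_ne (hle _) hcon
      have := hjmax ⟨j + 1, hjn⟩ (by simp [S, hlt])
      have : (j : ℕ) + 1 ≤ j := this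
      omega
    · rw [cexp_of_ge m (by omega), cexp_of_ge P (by omega)]
  have hmj : m j < P j := by
    have h1 := cexp_succ m j
    have h2 := cexp_succ P j
    omega
  let T : Finset (Fin n) := Finset.univ.filter (fun k : Fin n => k < j ∧ 0 < m k)
  -- if no positive exponent in [a, j), cexp is constant
  have hconst : ∀ a : ℕ, a ≤ j → (∀ k : Fin n, a ≤ (k : ℕ) → k < j → m k = 0) →
      cexp m a = cexp m j := by
    intro a ha hz
    unfold cexp
    apply Finset.sum_congr rfl
    intro x _
    by_cases h1 : (j : ℕ) ≤ x
    · rw [if_pos h1, if_pos (by omega)]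
    · rw [if_neg h1]
      split_ifs with h2
      · exact hz x h2 (by rw [Fin.lt_def]; omega)
      · rfl
  have hT : T.Nonempty := by
    by_contra hcon
    rw [Finset.not_nonempty_iff_eq_empty] at hcon
    have := hconst 0 (by omega) (by
      intro k _ hk
      by_contra hk0
      have : k ∈ T := by simp [T, hk]; omega
      rw [hcon] at this
      simp at this)
    have h2 := cexp_anti P (Nat.zero_le (j : ℕ))
    omega
  obtain ⟨i, hiT, himax⟩ := T.exists_max_image id hT
  have hi : i < j ∧ 0 < m i := by simpa [T] using hiT
  refine ⟨i, j, hi.1, hi.2, hmj, ?_, ?_⟩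
  · intro k
    rw [cexp_mshift m i j hi.1 hi.2]
    split_ifs with hk
    · have := hconst k hk.2 (by
        intro l hl hlj
        by_contra hl0
        have hlT : l ∈ T := by simp [T, hlj]; omega
        have : (l : ℕ) ≤ i := himax l hlT
        omega)
      have h2 := cexp_anti P hk.2
      omega
    · simpa using hle k
  · rw [cexp_mshift m i j hi.1 hi.2]
    simpa using h0

theorem mshift_mshift (m : Fin n → ℕ) (i j : Fin n) (hij : i ≠ j) (hi : 0 < m i) :
    mshift (mshift m i j) j i = m := by
  funext k
  unfold mshift
  by_cases h1 : k = i
  · subst h1; simp [hij]; omega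
  · by_cases h2 : k = j
    · subst h2; simp [h1]
    · simp [h1, h2]

theorem borelStep_back (m : Fin n → ℕ) (i j : Fin n) (hij : i < j) (hi : 0 < m i) :
    BorelStep (mshift m i j) m :=
  ⟨i, j, hij, by simp [mshift], (mshift_mshift m i j hij.ne hi).symm⟩

theorem dom_of_inBorel {m P : Fin n → ℕ} (h : InBorel m P) : Dom m P := by
  induction h with
  | refl => exact ⟨fun _ => le_rfl, rfl⟩
  | @tail a b _ hab ih =>
    obtain ⟨i, j, hij, ha, rfl⟩ := hab
    have hb : 0 < mshift a j i i := by simp [mshift]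
    have hf := cexp_mshift (mshift a j i) i j hij hb
    rw [mshift_mshift a j i hij.ne' ha] at hf
    refine ⟨fun k => ?_, ?_⟩
    · have := hf k
      have := ih.1 k
      omega
    · have h1 := hf 0
      have := ih.2
      simp at h1
      omega

theorem inBorel_of_dom (m P : Fin n → ℕ) (h : Dom m P) : InBorel m P := by
  have main : ∀ s : ℕ, ∀ m : Fin n → ℕ, Dom m P →
      (∑ k ∈ Finset.range n, cexp P k) ≤ s + (∑ k ∈ Finset.range n, cexp m k) →
      InBorel m P := by
    intro s
    induction s with
    | zero =>
      intro m hm hs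
      by_cases hne : m = P
      · subst hne; exact Relation.ReflTransGen.refl
      exfalso
      obtain ⟨i, j, hij, hi, hj, hd⟩ := dom_improve m P hm hne
      have h1 : ∑ k ∈ Finset.range n, cexp m k < ∑ k ∈ Finset.range n, cexp P k := by
        apply Finset.sum_lt_sum (fun k _ => hm.1 k)
        refine ⟨j, by simp, ?_⟩
        have := hd.1 j
        rw [cexp_mshift m i j hij hi, if_pos ⟨hij, le_rfl⟩] at this
        omega
      omega
    | succ s ih =>
      intro m hm hs
      by_cases hne : m = P
      · subst hne; exact Relation.ReflTransGen.refl
      obtain ⟨i, j, hij, hi, hj, hd⟩ := dom_improve m P hm hne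
      have h1 : ∑ k ∈ Finset.range n, cexp m k
          < ∑ k ∈ Finset.range n, cexp (mshift m i j) k := by
        apply Finset.sum_lt_sum
        · intro k _
          rw [cexp_mshift m i j hij hi]; omega
        · refine ⟨j, by simp, ?_⟩
          rw [cexp_mshift m i j hij hi, if_pos ⟨hij, le_rfl⟩]
          omega
      exact (ih _ hd (by omega)).tail (borelStep_back m i j hij hi)
  exact main _ m h (Nat.le_add_right _ _)

theorem mLexLt_iff (a b : Fin n → ℕ) : mLexLt a b ↔ toLex a < toLex b := Iff.rfl

theorem mshift_lex_up (v : Fin n → ℕ) (i j : Fin n) (hij : i < j) :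
    toLex v < toLex (mshift v j i) := by
  rw [← mLexLt_iff]
  refine ⟨i, fun k hk => ?_, by simp [mshift]⟩
  simp [mshift, hk.ne, (hk.trans hij).ne]

theorem mshift_lex_down (e : Fin n → ℕ) (i j : Fin n) (hij : i < j) (hi : 0 < e i) :
    toLex (mshift e i j) < toLex e := by
  have := mshift_lex_up (mshift e i j) i j hij
  rwa [mshift_mshift e i j hij.ne hi] at this

theorem mshift_add (e v : Fin n → ℕ) (i j : Fin n) (hij : i < j) (hi : 0 < e i) (hj : 0 < v j) :
    mshift e i j + mshift v j i = e + v := by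
  funext k
  simp only [Pi.add_apply]
  unfold mshift
  by_cases h1 : k = i
  · subst h1; simp [hij.ne]; omega
  · by_cases h2 : k = j
    · subst h2; simp [h1]; omega
    · simp [h1, h2]

theorem exists_repl (P μ e : Fin n → ℕ) (Z : Multiset (Fin n → ℕ)) (hsum : Z.sum = μ)
    (hP : mDvd P μ) (he : e ∈ Z) (heP : InBorel e P) (hne : e ≠ P) :
    ∃ (W : Multiset (Fin n → ℕ)) (v : Fin n → ℕ) (i j : Fin n), i < j ∧ Z = e ::ₘ v ::ₘ W ∧
      0 < e i ∧ 0 < v j ∧ InBorel (mshift e i j) P := by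
  obtain ⟨i, j, hij, hi, hj, hd⟩ := dom_improve e P (dom_of_inBorel heP) hne
  obtain ⟨Y, rfl⟩ := Multiset.exists_cons_of_mem he
  have hv : ∃ v ∈ Y, 0 < v j := by
    by_contra hcon
    push Not at hcon
    have h0 : Y.sum j = 0 := by
      have : Y.sum j = (Y.map (fun v => v j)).sum :=
        map_multiset_sum (Pi.evalAddMonoidHom (fun _ : Fin n => ℕ) j) Y
      rw [this]
      apply Multiset.sum_eq_zero
      intro x hx
      obtain ⟨v, hv, rfl⟩ := Multiset.mem_map.1 hx
      have := hcon v hv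
      omega
    have h1 := hP j
    rw [← hsum, Multiset.sum_cons, Pi.add_apply, h0] at h1
    omega
  obtain ⟨v, hvY, hvj⟩ := hv
  obtain ⟨W, rfl⟩ := Multiset.exists_cons_of_mem hvY
  exact ⟨W, v, i, j, hij, rfl, hi, hvj, inBorel_of_dom _ _ hd⟩

theorem inBorel_mshift {v P : Fin n → ℕ} (h : InBorel v P) (i j : Fin n) (hij : i < j)
    (hj : 0 < v j) : InBorel (mshift v j i) P :=
  Relation.ReflTransGen.tail h ⟨i, j, hij, hj, rfl⟩

theorem later_aux (M N e v e' v' w : Fin n → ℕ) (W : Multiset (Fin n → ℕ))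
    (hw : w = e' ∨ w = v') (hwe : w ≠ e) (hwv : w ≠ v)
    (h : ∀ u, varBefore M N w u → u ≠ e ∧ u ≠ v ∧ u ≠ e' ∧ u ≠ v') :
    laterThan M N (e' ::ₘ v' ::ₘ W) (e ::ₘ v ::ₘ W) := by
  refine ⟨w, ?_, ?_⟩
  · simp only [Multiset.count_cons, if_neg hwe, if_neg hwv]
    rcases hw with rfl | rfl
    · simp
    · simp; omega
  · intro u hu
    obtain ⟨h1, h2, h3, h4⟩ := h u hu
    simp [Multiset.count_cons, h1, h2, h3, h4]

theorem fiber_repl (M N μ e v : Fin n → ℕ) (W : Multiset (Fin n → ℕ)) (i j : Fin n)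
    (hij : i < j) (hi : 0 < e i) (hj : 0 < v j)
    (hZ : FiberVertex (gens2 M N) μ (e ::ₘ v ::ₘ W))
    (he' : mshift e i j ∈ gens2 M N) (hv' : mshift v j i ∈ gens2 M N) :
    FiberVertex (gens2 M N) μ (mshift e i j ::ₘ mshift v j i ::ₘ W) := by
  refine ⟨?_, ?_⟩
  · intro w hw
    rcases Multiset.mem_cons.1 hw with rfl | hw
    · exact he'
    rcases Multiset.mem_cons.1 hw with rfl | hw
    · exact hv'
    exact hZ.1 w (by simp [hw])
  · rw [← hZ.2]
    simp only [Multiset.sum_cons]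
    rw [← add_assoc, mshift_add e v i j hij hi hj, add_assoc]

/-- Let `I = Borel(M,N)` be a two-Borel ideal (`M`, `N` of the same degree
`d`, `M` lex-earlier than `N`) and let `μ` be divisible by both `M` and `N`.  If a vertex
`Z` of `Γ_μ(I)` has type `N` and `N ∉ Z`, then a type `N` replacement of `Z` exists; if `Z`
has type `M` and `M ∉ Z`, then a type `M` replacement of `Z` exists.  In either case the
replacement is a vertex of `Γ_μ(I)` later than `Z` in the fiber sink order (so `Z` is not a
sink of `→Γ_μ(I)`). -/
theorem statement11 (M N μ : Fin n → ℕ) (d : ℕ) (hMd : mDeg M = d) (hNd : mDeg N = d)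
    (hlex : mLexLt N M) (hMμ : mDvd M μ) (hNμ : mDvd N μ)
    (Z : Multiset (Fin n → ℕ)) (hZ : FiberVertex (gens2 M N) μ Z) :
    ((∀ w ∈ Z, w ∈ gensN M N) → N ∉ Z →
      ∃ Z', TypeNRepl M N Z Z' ∧ FiberVertex (gens2 M N) μ Z' ∧ laterThan M N Z' Z) ∧
    ((∃ w ∈ Z, w ∈ gensM M) → M ∉ Z →
      ∃ Z', TypeMRepl M N Z Z' ∧ FiberVertex (gens2 M N) μ Z' ∧ laterThan M N Z' Z) := by
  classical
  have hdisj : ∀ w, w ∈ gensN M N → w ∈ gensM M → False := fun w h1 h2 => h1.2 h2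
  have hmove : ∀ (v : Fin n → ℕ) (i j : Fin n), i < j → 0 < v j → v ∈ gens2 M N →
      mshift v j i ∈ gens2 M N := by
    intro v i j hij hj hv
    rcases hv with h | h
    · exact Or.inl (inBorel_mshift h i j hij hj)
    · exact Or.inr (inBorel_mshift h i j hij hj)
  constructor
  · intro hall hNZ
    have hZne : Z.toFinset.Nonempty := by
      rw [Multiset.toFinset_nonempty]
      rintro rfl
      obtain ⟨i, _, hi⟩ := hlex
      have hμ0 : μ = 0 := by rw [← hZ.2]; simp
      have := hMμ i
      rw [hμ0] at this
      simp at this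
      omega
    obtain ⟨e, heZ, hemin⟩ := Z.toFinset.exists_min_image toLex hZne
    rw [Multiset.mem_toFinset] at heZ
    have heN := hall e heZ
    obtain ⟨W, v, i, j, hij, hZeq, hi, hj, hB⟩ := exists_repl N μ e Z hZ.2 hNμ heZ heN.1
      (fun h => hNZ (h ▸ heZ))
    have hvZ : v ∈ Z := by rw [hZeq]; simp
    have he' : mshift e i j ∈ gens2 M N := Or.inr hB
    have hv' := hmove v i j hij hj (hZ.1 v hvZ)
    have he'N : mshift e i j ∈ gensN M N :=
      ⟨hB, fun h => heN.2 (Relation.ReflTransGen.tail h (borelStep_back e i j hij hi))⟩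
    have hvN := hall v hvZ
    refine ⟨_, ⟨W, e, v, i, j, hij, hZeq, ?_, hi, hj, rfl, he', hv'⟩, ?_, ?_⟩
    · intro w hw
      rcases (hemin w (by simpa using hw)).lt_or_eq with h | h
      · exact Or.inr (Or.inr (Or.inl ⟨heN, hall w hw, h⟩))
      · exact Or.inl (toLex.injective h.symm)
    · exact fiber_repl M N μ e v W i j hij hi hj (hZeq ▸ hZ) he' hv'
    · rw [hZeq]
      have l1 : toLex e ≤ toLex v := hemin v (by simpa using hvZ)
      have l2 := mshift_lex_up v i j hij
      have l3 := mshift_lex_down e i j hij hi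
      have hno : ∀ u, u ∈ gensN M N → toLex u < toLex (mshift v j i) →
          ¬ varBefore M N (mshift v j i) u := by
        rintro u hu hlt (⟨_, h⟩ | ⟨_, _, h⟩ | ⟨_, h, _⟩)
        · exact hdisj u hu h
        · exact lt_asymm hlt h
        · exact hdisj u hu h
      have hself : ¬ varBefore M N (mshift v j i) (mshift v j i) := by
        rintro (⟨h1, h⟩ | ⟨_, _, h⟩ | ⟨_, _, h⟩)
        · exact hdisj _ h1 h
        · exact lt_irrefl _ ((mLexLt_iff _ _).1 h)
        · exact lt_irrefl _ ((mLexLt_iff _ _).1 h)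
      refine later_aux M N e v _ _ (mshift v j i) W (Or.inr rfl) ?_ ?_ ?_
      · intro h; rw [h] at l2; exact absurd l2 (not_lt.2 l1)
      · intro h; rw [h] at l2; exact lt_irrefl _ l2
      · intro u hu
        refine ⟨?_, ?_, ?_, ?_⟩
        · rintro rfl; exact hno _ heN (l1.trans_lt l2) hu
        · rintro rfl; exact hno _ hvN l2 hu
        · rintro rfl; exact hno _ he'N (l3.trans_le (l1.trans l2.le)) hu
        · rintro rfl; exact hself hu
  · rintro ⟨w₀, hw₀Z, hw₀⟩ hMZ
    let S := Z.toFinset.filter (fun w => w ∈ gensM M)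
    have hS : S.Nonempty := ⟨w₀, by simp [S, hw₀Z, hw₀]⟩
    obtain ⟨e, heS, hemin⟩ := S.exists_min_image toLex hS
    have heS' : e ∈ Z ∧ e ∈ gensM M := by simpa [S] using heS
    obtain ⟨heZ, heM⟩ := heS'
    have hmin : ∀ w ∈ Z, w ∈ gensM M → toLex e ≤ toLex w := fun w h1 h2 =>
      hemin w (by simp [S, h1, h2])
    obtain ⟨W, v, i, j, hij, hZeq, hi, hj, hB⟩ := exists_repl M μ e Z hZ.2 hMμ heZ heM
      (fun h => hMZ (h ▸ heZ))
    have hvZ : v ∈ Z := by rw [hZeq]; simp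
    have he' : mshift e i j ∈ gens2 M N := Or.inl hB
    have hv' := hmove v i j hij hj (hZ.1 v hvZ)
    have he'M : mshift e i j ∈ gensM M := hB
    refine ⟨_, ⟨W, e, v, i, j, hij, hZeq, ?_, hi, hj, rfl, he', hv'⟩, ?_, ?_⟩
    · intro w hw
      by_cases hwM : w ∈ gensM M
      · rcases (hmin w hw hwM).lt_or_eq with h | h
        · exact Or.inr (Or.inr (Or.inr ⟨hwM, heM, h⟩))
        · exact Or.inl (toLex.injective h.symm)
      · exact Or.inr (Or.inl ⟨⟨(hZ.1 w hw).resolve_left hwM, hwM⟩, heM⟩)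
    · exact fiber_repl M N μ e v W i j hij hi hj (hZeq ▸ hZ) he' hv'
    · rw [hZeq]
      have l1 : v ∈ gensM M → toLex e ≤ toLex v := hmin v hvZ
      have l2 := mshift_lex_up v i j hij
      have l3 := mshift_lex_down e i j hij hi
      have hbef : ∀ w u, w ∈ gensM M → varBefore M N w u →
          u ∈ gensM M ∧ toLex u < toLex w := by
        rintro w u hw (⟨h, _⟩ | ⟨h, _, _⟩ | ⟨_, h, h'⟩)
        · exact (hdisj w h hw).elim
        · exact (hdisj w h hw).elim
        · exact ⟨h, h'⟩
      by_cases hc : mshift v j i ∈ gensM M ∧ toLex (mshift v j i) < toLex (mshift e i j)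
      · obtain ⟨hcM, hclt⟩ := hc
        have hvM : v ∉ gensM M := fun h =>
          absurd ((l1 h).trans_lt l2) (not_lt.2 (hclt.trans l3).le)
        refine later_aux M N e v _ _ (mshift v j i) W (Or.inr rfl) ?_ ?_ ?_
        · intro h; rw [h] at hclt; exact lt_asymm hclt l3
        · intro h; rw [h] at l2; exact lt_irrefl _ l2
        · intro u hu
          obtain ⟨huM, hult⟩ := hbef _ u hcM hu
          refine ⟨?_, ?_, ?_, ?_⟩
          · rintro rfl; exact lt_asymm hult (hclt.trans l3)
          · rintro rfl; exact hvM huM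
          · rintro rfl; exact lt_asymm hult hclt
          · rintro rfl; exact lt_irrefl _ hult
      · refine later_aux M N e v _ _ (mshift e i j) W (Or.inl rfl) ?_ ?_ ?_
        · intro h; rw [h] at l3; exact lt_irrefl _ l3
        · intro h
          have := l1 (h ▸ he'M)
          rw [← h] at this
          exact absurd l3 (not_lt.2 this)
        · intro u hu
          obtain ⟨huM, hult⟩ := hbef _ u he'M hu
          refine ⟨?_, ?_, ?_, ?_⟩
          · rintro rfl; exact lt_asymm hult l3
          · rintro rfl; exact absurd (hult.trans l3) (not_lt.2 (l1 huM))
          · rintro rfl; exact lt_irrefl _ hult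
          · rintro rfl; exact hc ⟨huM, hult⟩
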